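/- The vector fields $\zeta_1, \zeta_2, \zeta_3$ on $\mathbb{R}^9$ satisfy the bracket relations: $[\zeta_1, \zeta_3] = 0$, $[\zeta_1, \zeta_2] = \zeta_5$, $[\zeta_2, \zeta_3] = \zeta_6$, $[\zeta_1, \zeta_6] = \zeta_8$, $[\zeta_3, \zeta_5] = -\zeta_8$, $[\zeta_3, \zeta_6] = \zeta_{10}$, $[\zeta_1, \zeta_{10}] = \zeta_{12}$, $[\zeta_3, \zeta_8] = \zeta_{12}$, and $[\zeta_2, \zeta_{12}] = \zeta_{15}$. -/

import Mathlib

noncomputable section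

/- Coordinates on `ℝ⁹`:
index 0 = z₁₁, 1 = z₁₃, 2 = z₁₄, 3 = z₁₅, 4 = z₁₆, 5 = z₂₁, 6 = z₂₄, 7 = z₂₅, 8 = z₃₁. -/

/-- Standard basis vector. -/
def e (i : Fin 9) : Fin 9 → ℝ := Pi.single i 1

/-- Lie bracket of vector fields on `ℝ⁹`: `[V,W](x) = DW(x)(V(x)) - DV(x)(W(x))`. -/
def vfBracket (V W : (Fin 9 → ℝ) → (Fin 9 → ℝ)) : (Fin 9 → ℝ) → (Fin 9 → ℝ) :=
  fun x => fderiv ℝ W x (V x) - fderiv ℝ V x (W x)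

def ζ1 : (Fin 9 → ℝ) → (Fin 9 → ℝ) :=
  fun m => e 1 + m 5 • e 0 + m 6 • e 2 + m 7 • e 3
    + (m 6 * m 7 - (1/4) * m 5 ^ 2) • e 4
def ζ2 : (Fin 9 → ℝ) → (Fin 9 → ℝ) :=
  fun m => e 6 + m 8 • e 5 + ((1/4) * m 8 ^ 2) • e 7
def ζ3 : (Fin 9 → ℝ) → (Fin 9 → ℝ) :=
  fun _ => e 8
def ζ5 : (Fin 9 → ℝ) → (Fin 9 → ℝ) :=
  fun m => -e 2 - m 8 • e 0 - ((1/4) * m 8 ^ 2) • e 3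
    + (-m 7 + (1/2) * m 5 * m 8 - (1/4) * m 6 * m 8 ^ 2) • e 4
def ζ6 : (Fin 9 → ℝ) → (Fin 9 → ℝ) :=
  fun m => -e 5 - ((1/2) * m 8) • e 7
def ζ8 : (Fin 9 → ℝ) → (Fin 9 → ℝ) :=
  fun m => e 0 + ((1/2) * m 8) • e 3 + (-(1/2) * m 5 + (1/2) * m 6 * m 8) • e 4
def ζ10 : (Fin 9 → ℝ) → (Fin 9 → ℝ) :=
  fun _ => -(1/2 : ℝ) • e 7
def ζ12 : (Fin 9 → ℝ) → (Fin 9 → ℝ) :=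
  fun m => (1/2 : ℝ) • e 3 + ((1/2) * m 6) • e 4
def ζ15 : (Fin 9 → ℝ) → (Fin 9 → ℝ) :=
  fun _ => (1/2 : ℝ) • e 4

section Derivatives

variable (x v : Fin 9 → ℝ)

lemma hasFDerivAt_coord (i : Fin 9) :
    HasFDerivAt (fun m : Fin 9 → ℝ => m i) (ContinuousLinearMap.proj (R := ℝ) i) x :=
  hasFDerivAt_apply i x

lemma fderiv_ζ1 : fderiv ℝ ζ1 x v = v 5 • e 0 + v 6 • e 2 + v 7 • e 3
    + (v 6 * x 7 + x 6 * v 7 - (1/2) * x 5 * v 5) • e 4 := by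
  have h := hasFDerivAt_coord x
  have H := (((((h 5).smul_const (e 0)).const_add (e 1)).add ((h 6).smul_const (e 2))).add
    ((h 7).smul_const (e 3))).add
    ((((h 6).mul (h 7)).sub (((h 5).pow 2).const_mul (1/4))).smul_const (e 4))
  rw [show fderiv ℝ ζ1 x = _ from H.fderiv]
  ext j
  simp [-mul_eq_mul_right_iff]
  ring

lemma fderiv_ζ2 : fderiv ℝ ζ2 x v = v 8 • e 5 + ((1/2) * x 8 * v 8) • e 7 := by
  have h := hasFDerivAt_coord x
  have H := (((h 8).smul_const (e 5)).const_add (e 6)).add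
    ((((h 8).pow 2).const_mul (1/4)).smul_const (e 7))
  rw [show fderiv ℝ ζ2 x = _ from H.fderiv]
  ext j
  simp [-mul_eq_mul_right_iff]
  ring

lemma fderiv_ζ3 : fderiv ℝ ζ3 x v = 0 := by
  simp [show ζ3 = fun _ => e 8 from rfl]

lemma fderiv_ζ5 : fderiv ℝ ζ5 x v = -(v 8 • e 0) - ((1/2) * x 8 * v 8) • e 3
    + (-v 7 + (1/2) * (v 5 * x 8 + x 5 * v 8)
      - (1/4) * (v 6 * x 8 ^ 2 + 2 * x 6 * x 8 * v 8)) • e 4 := by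
  have h := hasFDerivAt_coord x
  have H := ((((h 8).smul_const (e 0)).const_sub (-e 2)).sub
    ((((h 8).pow 2).const_mul (1/4)).smul_const (e 3))).add
    ((((h 7).neg.add (((h 5).const_mul (1/2)).mul (h 8))).sub
      (((h 6).const_mul (1/4)).mul ((h 8).pow 2))).smul_const (e 4))
  rw [show fderiv ℝ ζ5 x = _ from H.fderiv]
  ext j
  simp [-mul_eq_mul_right_iff]
  ring

lemma fderiv_ζ6 : fderiv ℝ ζ6 x v = -(((1/2) * v 8) • e 7) := by
  have H := (((hasFDerivAt_coord x 8).const_mul (1/2)).smul_const (e 7)).const_sub (-e 5)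
  rw [show fderiv ℝ ζ6 x = _ from H.fderiv]
  ext j
  simp [-mul_eq_mul_right_iff]

lemma fderiv_ζ8 : fderiv ℝ ζ8 x v = ((1/2) * v 8) • e 3
    + (-(1/2) * v 5 + (1/2) * (v 6 * x 8 + x 6 * v 8)) • e 4 := by
  have h := hasFDerivAt_coord x
  have H := ((((h 8).const_mul (1/2)).smul_const (e 3)).const_add (e 0)).add
    ((((h 5).const_mul (-(1/2))).add (((h 6).const_mul (1/2)).mul (h 8))).smul_const (e 4))
  rw [show fderiv ℝ ζ8 x = _ from H.fderiv]
  ext j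
  simp [-mul_eq_mul_right_iff]
  ring

lemma fderiv_ζ10 : fderiv ℝ ζ10 x v = 0 := by
  simp [show ζ10 = fun _ => -(1/2 : ℝ) • e 7 from rfl]

lemma fderiv_ζ12 : fderiv ℝ ζ12 x v = ((1/2) * v 6) • e 4 := by
  have H := (((hasFDerivAt_coord x 6).const_mul (1/2)).smul_const (e 4)).const_add
    ((1/2 : ℝ) • e 3)
  rw [show fderiv ℝ ζ12 x = _ from H.fderiv]
  ext j
  simp [-mul_eq_mul_right_iff]

end Derivatives

/-- Bracket relations among the generators of the prolonged distribution in null-flag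
fiber coordinates. -/
theorem zeta_bracket_relations :
    vfBracket ζ1 ζ3 = 0 ∧
    vfBracket ζ1 ζ2 = ζ5 ∧
    vfBracket ζ2 ζ3 = ζ6 ∧
    vfBracket ζ1 ζ6 = ζ8 ∧
    vfBracket ζ3 ζ5 = -ζ8 ∧
    vfBracket ζ3 ζ6 = ζ10 ∧
    vfBracket ζ1 ζ10 = ζ12 ∧
    vfBracket ζ3 ζ8 = ζ12 ∧
    vfBracket ζ2 ζ12 = ζ15 := by
  refine ⟨?_, ?_, ?_, ?_, ?_, ?_, ?_, ?_, ?_⟩ <;> ext x j <;>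
    simp only [vfBracket, fderiv_ζ1, fderiv_ζ2, fderiv_ζ3, fderiv_ζ5, fderiv_ζ6, fderiv_ζ8,
      fderiv_ζ10, fderiv_ζ12] <;>
    fin_cases j <;>
    simp [ζ1, ζ2, ζ3, ζ5, ζ6, ζ8, ζ10, ζ12, ζ15, e] <;>
    ring

end
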